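/- Let P be a simple logic program and let E(P) be the extended version of P, obtained by replacing each rule a ← β of P by a ← β, not ¬a (constraints are left unchanged). Then the extended answer sets of P coincide with the answer sets of E(P). -/

import Mathlib

namespace ASP

/-- A literal is an atom `a` or a negated atom `¬ a`. -/
inductive Lit (α : Type) : Type where
  | pos (a : α)
  | neg (a : α)
deriving DecidableEq

/-- Classical negation of a literal. -/
def Lit.negate {α : Type} : Lit α → Lit α
  | .pos a => .neg a
  | .neg a => .pos a

/-- The atom underlying a literal. -/
def Lit.atom {α : Type} : Lit α → α
  | .pos a => a
  | .neg a => a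

/-- A rule of a simple logic program: a head which is a literal or absent
(a constraint), and a finite set of literals as body. -/
structure Rule (α : Type) [DecidableEq α] : Type where
  head : Option (Lit α)
  body : Finset (Lit α)

variable {α : Type} [DecidableEq α]

/-- A set of literals is consistent if it contains no complementary pair. -/
def Consistent (I : Set (Lit α)) : Prop :=
  ∀ a : α, ¬(Lit.pos a ∈ I ∧ Lit.neg a ∈ I)

/-- The Herbrand base of a program: all atoms occurring in it. -/
def herbrand (P : Set (Rule α)) : Set α :=
  {a | ∃ r ∈ P, (∃ l, r.head = some l ∧ l.atom = a) ∨ (∃ l ∈ r.body, l.atom = a)}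

/-- An interpretation of `P`: a consistent set of literals over the Herbrand base of `P`. -/
def IsInterp (P : Set (Rule α)) (I : Set (Lit α)) : Prop :=
  Consistent I ∧ ∀ l ∈ I, l.atom ∈ herbrand P

/-- A rule `a ← β` is satisfied by `I` if `a ∈ I` whenever `β ⊆ I`;
a constraint `← β` is satisfied if its body is not contained in `I`. -/
def Satisfied (I : Set (Lit α)) (r : Rule α) : Prop :=
  ↑r.body ⊆ I → ∃ l, r.head = some l ∧ l ∈ I

/-- A rule is applied w.r.t. `I` if its body holds and its head literal is in `I`. -/
def Applied (I : Set (Lit α)) (r : Rule α) : Prop :=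
  ↑r.body ⊆ I ∧ ∃ l, r.head = some l ∧ l ∈ I

/-- A rule `a ← β` is defeated w.r.t. `P` and `I` iff `P` contains an applied
competing rule `¬a ← β'`. -/
def Defeated (P : Set (Rule α)) (I : Set (Lit α)) (r : Rule α) : Prop :=
  ∃ l, r.head = some l ∧ ∃ r' ∈ P, r'.head = some l.negate ∧ Applied I r'

/-- The reduct of `P` w.r.t. `I`: the rules of `P` satisfied by `I`. -/
def reduct (P : Set (Rule α)) (I : Set (Lit α)) : Set (Rule α) :=
  {r ∈ P | Satisfied I r}

/-- `star R` is the unique minimal model of `R` viewed as a positive program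
(negative literals treated as fresh atoms; constraints never fire their head). -/
def star (R : Set (Rule α)) : Set (Lit α) :=
  ⋂₀ {J : Set (Lit α) | ∀ r ∈ R, ↑r.body ⊆ J → ∀ l, r.head = some l → l ∈ J}

/-- An interpretation is founded iff `(P_I)* = I`. -/
def Founded (P : Set (Rule α)) (I : Set (Lit α)) : Prop :=
  star (reduct P I) = I

/-- A founded interpretation `M` is an extended answer set of `P` iff every rule
of `P` is satisfied or defeated w.r.t. `M`. -/
def ExtAnswerSet (P : Set (Rule α)) (M : Set (Lit α)) : Prop :=
  IsInterp P M ∧ Founded P M ∧ ∀ r ∈ P, Satisfied M r ∨ Defeated P M r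

/-- An answer set of a program without negation as failure: a minimal
interpretation satisfying all rules of the program. -/
def IsAnswerSet (P : Set (Rule α)) (M : Set (Lit α)) : Prop :=
  IsInterp P M ∧ (∀ r ∈ P, Satisfied M r) ∧
    ∀ J, IsInterp P J → (∀ r ∈ P, Satisfied J r) → ¬J ⊂ M


/-- A rule possibly containing negation as failure in its body: head a literal
or absent, body a finite set of literals (`bodyLit`) together with a finite set
of naf-literals `not l` for `l ∈ bodyNaf`. -/
structure NRule (α : Type) [DecidableEq α] : Type where
  head : Option (Lit α)
  bodyLit : Finset (Lit α)
  bodyNaf : Finset (Lit α)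

variable {α : Type} [DecidableEq α]

/-- The Gelfond–Lifschitz reduct of a program with naf in rule bodies w.r.t.
`I`: delete each rule containing `not l` with `l ∈ I`, and remove all remaining
naf-literals from the bodies. -/
def GLreduct (Q : Set (NRule α)) (I : Set (Lit α)) : Set (Rule α) :=
  {r | ∃ q ∈ Q, (∀ l ∈ q.bodyNaf, l ∉ I) ∧ r = ⟨q.head, q.bodyLit⟩}

/-- `I` is an answer set of a program `Q` with naf in rule bodies iff `I` is an
answer set of the Gelfond–Lifschitz reduct `Q^I`. -/
def NafAnswerSet (Q : Set (NRule α)) (I : Set (Lit α)) : Prop :=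
  IsAnswerSet (GLreduct Q I) I

/-- The extended version `E(P)` of a simple program `P`: each rule `a ← β` is
replaced by `a ← β, not ¬a`; constraints are left unchanged. -/
def extendedVersion (P : Set (Rule α)) : Set (NRule α) :=
  {q | ∃ r ∈ P,
    (r.head = none ∧ q = ⟨none, r.body, ∅⟩) ∨
    (∃ l, r.head = some l ∧ q = ⟨some l, r.body, {l.negate}⟩)}

theorem Consistent.negate_notMem {β : Type} {I : Set (Lit β)} (hI : Consistent I) {l : Lit β}
    (hl : l ∈ I) : l.negate ∉ I := by
  intro hn
  cases l with
  | pos a => exact hI a ⟨hl, hn⟩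
  | neg a => exact hI a ⟨hn, hl⟩

theorem Consistent.subset {β : Type} {I J : Set (Lit β)} (hI : Consistent I) (hJ : J ⊆ I) :
    Consistent J :=
  fun a h => hI a ⟨hJ h.1, hJ h.2⟩

/-- Every literal of the minimal model of a positive program is the head of a rule whose body
holds in that model. -/
theorem exists_rule_of_mem_star {R : Set (Rule α)} {l : Lit α} (hl : l ∈ star R) :
    ∃ r ∈ R, r.head = some l ∧ ↑r.body ⊆ star R := by
  by_contra! h
  refine (hl (star R \ {l}) fun r hr hb k hk => ⟨?_, ?_⟩).2 rfl
  · exact fun J hJ => hJ r hr ((hb.trans Set.sdiff_subset).trans (Set.sInter_subset_of_mem hJ)) k hk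
  · rintro rfl
    exact h r hr hk (hb.trans Set.sdiff_subset)

theorem mem_GLreduct_extendedVersion {P : Set (Rule α)} {M : Set (Lit α)} {r : Rule α} :
    r ∈ GLreduct (extendedVersion P) M ↔ r ∈ P ∧ ∀ l, r.head = some l → l.negate ∉ M := by
  constructor
  · rintro ⟨q, ⟨⟨hd, b⟩, hr, ⟨hh, rfl⟩ | ⟨l, hh, rfl⟩⟩, hn, rfl⟩
    · obtain rfl : hd = none := hh
      exact ⟨hr, by simp⟩
    · obtain rfl : hd = some l := hh
      refine ⟨hr, fun k hk => hn _ ?_⟩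
      obtain rfl := Option.some.inj hk
      simp
  · rintro ⟨hr, hn⟩
    obtain ⟨_ | l, b⟩ := r
    · exact ⟨_, ⟨_, hr, Or.inl ⟨rfl, rfl⟩⟩, by simp, rfl⟩
    · exact ⟨_, ⟨_, hr, Or.inr ⟨l, rfl, rfl⟩⟩, by simpa using hn, rfl⟩

theorem GLreduct_extendedVersion_subset (P : Set (Rule α)) (M : Set (Lit α)) :
    GLreduct (extendedVersion P) M ⊆ P :=
  fun _ hr => (mem_GLreduct_extendedVersion.1 hr).1

theorem herbrand_mono {P Q : Set (Rule α)} (h : P ⊆ Q) : herbrand P ⊆ herbrand Q :=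
  fun _ ⟨r, hr, ha⟩ => ⟨r, h hr, ha⟩

theorem ExtAnswerSet.nafAnswerSet {P : Set (Rule α)} {M : Set (Lit α)} (h : ExtAnswerSet P M) :
    NafAnswerSet (extendedVersion P) M := by
  obtain ⟨⟨hc, -⟩, hf, hs⟩ := h
  have hmem {r : Rule α} (hr : r ∈ P) {l : Lit α} (hh : r.head = some l) (hl : l ∈ M) :
      r ∈ GLreduct (extendedVersion P) M := by
    refine mem_GLreduct_extendedVersion.2 ⟨hr, fun k hk => ?_⟩
    obtain rfl := Option.some.inj (hh.symm.trans hk)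
    exact hc.negate_notMem hl
  refine ⟨⟨hc, fun l hl => ?_⟩, fun r hr => ?_, fun J _ hJ hJM => hJM.2 ?_⟩
  · obtain ⟨r, hr, hh, -⟩ := exists_rule_of_mem_star (hf.symm ▸ hl : l ∈ star (reduct P M))
    exact ⟨r, hmem hr.1 hh hl, Or.inl ⟨l, hh, rfl⟩⟩
  · obtain ⟨hrP, hn⟩ := mem_GLreduct_extendedVersion.1 hr
    refine (hs r hrP).resolve_right ?_
    rintro ⟨l, hh, r', -, hh', -, k, hk, hkM⟩
    obtain rfl := Option.some.inj (hh'.symm.trans hk)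
    exact hn l hh hkM
  · refine hf.symm.subset.trans (Set.sInter_subset_of_mem fun r hr hb l hh => ?_)
    obtain ⟨k, hk, hkM⟩ := hr.2 (hb.trans hJM.1)
    obtain ⟨k', hk', hkJ⟩ := hJ r (hmem hr.1 hk hkM) hb
    obtain rfl := Option.some.inj (hh.symm.trans hk')
    exact hkJ

theorem NafAnswerSet.extAnswerSet {P : Set (Rule α)} {M : Set (Lit α)}
    (h : NafAnswerSet (extendedVersion P) M) : ExtAnswerSet P M := by
  obtain ⟨⟨hc, hb⟩, hs, hmin⟩ := h
  have hf : Founded P M := by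
    refine Set.Subset.antisymm (Set.sInter_subset_of_mem fun r hr hrb l hh => ?_)
      (Set.subset_sInter fun J hJ => ?_)
    · obtain ⟨k, hk, hkM⟩ := hr.2 hrb
      obtain rfl := Option.some.inj (hh.symm.trans hk)
      exact hkM
    · by_contra hMJ
      refine hmin (J ∩ M) ⟨hc.subset Set.inter_subset_right, fun l hl => hb l hl.2⟩
        (fun r hr hrb => ?_)
        ⟨Set.inter_subset_right, fun hM => hMJ (hM.trans Set.inter_subset_left)⟩
      obtain ⟨l, hh, hl⟩ := hs r hr (hrb.trans Set.inter_subset_right)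
      exact ⟨l, hh, hJ r ⟨GLreduct_extendedVersion_subset P M hr, hs r hr⟩
        (hrb.trans Set.inter_subset_left) l hh, hl⟩
  refine ⟨⟨hc, fun l hl => herbrand_mono (GLreduct_extendedVersion_subset P M) (hb l hl)⟩, hf,
    fun r hr => or_iff_not_imp_left.2 fun hns => ?_⟩
  have hnG : r ∉ GLreduct (extendedVersion P) M := fun hG => hns (hs r hG)
  rw [mem_GLreduct_extendedVersion] at hnG
  push Not at hnG
  obtain ⟨l, hh, hl⟩ := hnG hr
  obtain ⟨r', hr', hh', hb'⟩ :=
    exists_rule_of_mem_star (hf.symm ▸ hl : l.negate ∈ star (reduct P M))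
  exact ⟨l, hh, r', hr'.1, hh', hb'.trans hf.subset, _, hh', hl⟩

/-- The extended answer sets of a simple logic program `P`
coincide with the answer sets of its extended version `E(P)`. -/
theorem extAnswerSet_iff_answerSet_extendedVersion
    (P : Set (Rule α)) (hP : P.Countable) (M : Set (Lit α)) :
    ExtAnswerSet P M ↔ NafAnswerSet (extendedVersion P) M :=
  ⟨ExtAnswerSet.nafAnswerSet, NafAnswerSet.extAnswerSet⟩

end ASP
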